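/- Let a, c ∈ (0,1) with a < c, write a' = 1−a, c' = 1−c, let X₁, X₂ be the solution of the linear system a'·X₁ + a·X₂ = a'·log₂ a' + a·log₂ a, c'·X₁ + c·X₂ = c'·log₂ c' + c·log₂ c, and define p₁ = (1/(c−a)) · (c·2^X₁ − c'·2^X₂)/(2^X₁ + 2^X₂) and p₂ = (1/(c−a)) · (−a·2^X₁ + a'·2^X₂)/(2^X₁ + 2^X₂). Then p₁ ≥ 0, p₂ ≥ 0 and p₁ + p₂ = 1; that is, (p₁, p₂) is a feasible probability distribution. -/

import Mathlib

/-- The tangent-line bound for the logarithm, scaled by the weight `x`. -/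
theorem mul_logb_two_sub_le {x y : ℝ} (hx : 0 < x) (hy : 0 < y) :
    x * (Real.logb 2 y - Real.logb 2 x) ≤ (y - x) / Real.log 2 := by
  have h2 : 0 < Real.log 2 := Real.log_pos one_lt_two
  have h : x * Real.log (y / x) ≤ x * (y / x - 1) :=
    mul_le_mul_of_nonneg_left (Real.log_le_sub_one_of_pos (div_pos hy hx)) hx.le
  rw [Real.log_div hy.ne' hx.ne', mul_sub_one, mul_div_cancel₀ _ hx.ne'] at h
  rw [Real.logb, Real.logb, ← sub_div, ← mul_div_assoc]
  gcongr

/-- Gibbs' inequality for two-point distributions. -/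
theorem binary_gibbs_inequality {x y : ℝ} (hx : 0 < x) (hx1 : x < 1) (hy : 0 < y) (hy1 : y < 1) :
    (1 - x) * Real.logb 2 (1 - y) + x * Real.logb 2 y ≤
      (1 - x) * Real.logb 2 (1 - x) + x * Real.logb 2 x := by
  have h := mul_logb_two_sub_le hx hy
  have h' := mul_logb_two_sub_le (sub_pos.2 hx1) (sub_pos.2 hy1)
  have hsum : (y - x) / Real.log 2 + (1 - y - (1 - x)) / Real.log 2 = 0 := by ring
  linarith

theorem mul_two_rpow_le_mul_two_rpow {u v x y : ℝ} (hu : 0 < u) (hv : 0 < v)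
    (h : Real.logb 2 u + x ≤ Real.logb 2 v + y) : u * (2 : ℝ) ^ x ≤ v * (2 : ℝ) ^ y := by
  have key : (2 : ℝ) ^ (Real.logb 2 u + x) ≤ (2 : ℝ) ^ (Real.logb 2 v + y) :=
    Real.rpow_le_rpow_of_exponent_le one_le_two h
  rwa [Real.rpow_add two_pos, Real.rpow_add two_pos,
    Real.rpow_logb two_pos (by norm_num) hu, Real.rpow_logb two_pos (by norm_num) hv] at key

/-- Feasibility of the optimal input distribution of a binary channel: the
probabilities `p₁, p₂` obtained from Muroga's construction are nonnegative
and sum to 1. -/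
theorem binary_channel_input_feasible
    (a c : ℝ) (ha : 0 < a) (ha1 : a < 1) (hc : 0 < c) (hc1 : c < 1)
    (hac : a < c)
    (a' c' X₁ X₂ : ℝ) (ha' : a' = 1 - a) (hc' : c' = 1 - c)
    (h1 : a' * X₁ + a * X₂ = a' * Real.logb 2 a' + a * Real.logb 2 a)
    (h2 : c' * X₁ + c * X₂ = c' * Real.logb 2 c' + c * Real.logb 2 c)
    (p₁ p₂ : ℝ)
    (hp₁ : p₁ = (1 / (c - a)) *
      ((c * (2:ℝ) ^ X₁ - c' * (2:ℝ) ^ X₂) / ((2:ℝ) ^ X₁ + (2:ℝ) ^ X₂)))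
    (hp₂ : p₂ = (1 / (c - a)) *
      ((-a * (2:ℝ) ^ X₁ + a' * (2:ℝ) ^ X₂) / ((2:ℝ) ^ X₁ + (2:ℝ) ^ X₂))) :
    0 ≤ p₁ ∧ 0 ≤ p₂ ∧ p₁ + p₂ = 1 := by
  subst ha' hc'
  have hd : 0 < c - a := sub_pos.2 hac
  have hS : 0 < (2 : ℝ) ^ X₁ + (2 : ℝ) ^ X₂ := by positivity
  have hgac := binary_gibbs_inequality ha ha1 hc hc1
  have hgca := binary_gibbs_inequality hc hc1 ha ha1
  have hle₁ : (1 - c) * (2 : ℝ) ^ X₂ ≤ c * (2 : ℝ) ^ X₁ := by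
    refine mul_two_rpow_le_mul_two_rpow (sub_pos.2 hc1) hc (le_of_mul_le_mul_left ?_ hd)
    linarith
  have hle₂ : a * (2 : ℝ) ^ X₁ ≤ (1 - a) * (2 : ℝ) ^ X₂ := by
    refine mul_two_rpow_le_mul_two_rpow ha (sub_pos.2 ha1) (le_of_mul_le_mul_left ?_ hd)
    linarith
  refine ⟨?_, ?_, ?_⟩
  · rw [hp₁]
    exact mul_nonneg (by positivity) (div_nonneg (by linarith) hS.le)
  · rw [hp₂]
    exact mul_nonneg (by positivity) (div_nonneg (by linarith) hS.le)
  · rw [hp₁, hp₂]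
    field_simp
    ring
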